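/- Let τ ∈ ℍ, k ∈ {1,2,3}, and (r,s) ∈ ℂ² with σ = r + sτ satisfying σ ∉ Λ_τ and σ ∉ ω_k/2 + Λ_τ. Then Z(r_k, s_k, τ) = Z(r,s,τ) + ℘′(σ|τ)/(2(℘(σ|τ) − e_k(τ))); consequently, the equation 2·Z(r,s,τ)·(℘(σ|τ) − e_k(τ)) + ℘′(σ|τ) = 0 holds if and only if Z(r_k, s_k, τ) = 0. -/

import Mathlib

open Metric Set Filter Topology

noncomputable section

/-- The lattice `Λ_τ = ℤ + τℤ` as a set of complex numbers. -/
def lat (τ : ℂ) : Set ℂ := {z | ∃ m n : ℤ, z = (m : ℂ) + (n : ℂ) * τ}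

/-- The lattice point `m + nτ` attached to a pair of integers. -/
def latPt (τ : ℂ) (p : ℤ × ℤ) : ℂ := (p.1 : ℂ) + (p.2 : ℂ) * τ

/-- The Weierstrass elliptic function `℘(z|τ)`. -/
def wp (τ z : ℂ) : ℂ :=
  1 / z ^ 2 + ∑' p : {p : ℤ × ℤ // p ≠ 0},
    (1 / (z - latPt τ p.1) ^ 2 - 1 / latPt τ p.1 ^ 2)

/-- `℘′(z|τ)`. -/
def wpd (τ z : ℂ) : ℂ := deriv (wp τ) z

/-- `℘″(z|τ)`. -/
def wpdd (τ z : ℂ) : ℂ := deriv (deriv (wp τ)) z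

/-- The Weierstrass zeta function `ζ(z|τ)` (odd primitive of `-℘`). -/
def wzeta (τ z : ℂ) : ℂ :=
  1 / z + ∑' p : {p : ℤ × ℤ // p ≠ 0},
    (1 / (z - latPt τ p.1) + 1 / latPt τ p.1 + z / latPt τ p.1 ^ 2)

/-- The Weierstrass sigma function `σ(z|τ)`. -/
def wsigma (τ z : ℂ) : ℂ :=
  z * ∏' p : {p : ℤ × ℤ // p ≠ 0},
    ((1 - z / latPt τ p.1) * Complex.exp (z / latPt τ p.1 + z ^ 2 / (2 * latPt τ p.1 ^ 2)))

/-- The periods `ω₀ = 0, ω₁ = 1, ω₂ = τ, ω₃ = 1 + τ`. -/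
def per (τ : ℂ) : ℕ → ℂ
  | 0 => 0
  | 1 => 1
  | 2 => τ
  | 3 => 1 + τ
  | _ => 0

/-- `e_k(τ) = ℘(ω_k/2|τ)`. -/
def eper (τ : ℂ) (k : ℕ) : ℂ := wp τ (per τ k / 2)

/-- The quasi-period `η₁(τ) = 2ζ(1/2|τ)`. -/
def eta1 (τ : ℂ) : ℂ := 2 * wzeta τ (1 / 2)

/-- The quasi-period `η₂(τ) = 2ζ(τ/2|τ)`. -/
def eta2 (τ : ℂ) : ℂ := 2 * wzeta τ (τ / 2)

/-- `η_k(τ)`, with `η₃ = η₁ + η₂`. -/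
def etaq (τ : ℂ) : ℕ → ℂ
  | 1 => eta1 τ
  | 2 => eta2 τ
  | 3 => eta1 τ + eta2 τ
  | _ => 0

/-- The Hecke form `Z(r,s,τ) = ζ(r+sτ|τ) - r η₁(τ) - s η₂(τ)`. -/
def heckeZ (r s τ : ℂ) : ℂ := wzeta τ (r + s * τ) - r * eta1 τ - s * eta2 τ

/-- The pre-modular form `Z^{(𝐦_k)}(r,s,τ) = Z(r,s,τ)² - ℘(r+sτ|τ) + e_k(τ)`. -/
def heckeZm (k : ℕ) (r s τ : ℂ) : ℂ := heckeZ r s τ ^ 2 - wp τ (r + s * τ) + eper τ k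

/-- First component of `(r_k, s_k)`. -/
def rkr (k : ℕ) (r : ℂ) : ℂ := if k = 2 then r else r + 1 / 2

/-- Second component of `(r_k, s_k)`. -/
def rks (k : ℕ) (s : ℂ) : ℂ := if k = 1 then s else s + 1 / 2

/-- `(r,s)` is a half-integer pair, i.e. belongs to `(1/2)ℤ²`. -/
def IsHalfIntPair (r s : ℂ) : Prop := ∃ m n : ℤ, r = (m : ℂ) / 2 ∧ s = (n : ℂ) / 2

/-- The singular set of the curvature equation: lattice translates of the points `ω_k/2`
with `m_k ≥ 1`. -/
def singSet (τ : ℂ) (m : Fin 4 → ℕ) : Set ℂ :=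
  {z | ∃ k : Fin 4, 1 ≤ m k ∧ ∃ l ∈ lat τ, z = per τ (k : ℕ) / 2 + l}

/-- The Laplacian of a real-valued function on `ℂ ≃ ℝ²`. -/
def lapl (u : ℂ → ℝ) (z : ℂ) : ℝ :=
  fderiv ℝ (fun w => fderiv ℝ u w (1 : ℂ)) z (1 : ℂ) +
  fderiv ℝ (fun w => fderiv ℝ u w Complex.I) z Complex.I

/-- `u` is a solution of the curvature equation `Δu + e^u = 8π Σ m_k δ_{ω_k/2}` on `E_τ`. -/
def IsCurvatureSolution (τ : ℂ) (m : Fin 4 → ℕ) (u : ℂ → ℝ) : Prop :=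
  (∀ z, u (z + 1) = u z) ∧ (∀ z, u (z + τ) = u z) ∧
  (∀ z ∉ singSet τ m, (∀ n : ℕ, ContDiffAt ℝ n u z) ∧ lapl u z + Real.exp (u z) = 0) ∧
  (∀ k : Fin 4, 1 ≤ m k → ∀ l ∈ lat τ,
    ∃ C ε : ℝ, 0 < ε ∧ ∀ z : ℂ, z ≠ per τ (k : ℕ) / 2 + l →
      dist z (per τ (k : ℕ) / 2 + l) < ε →
      |u z - 4 * (m k : ℝ) * Real.log (dist z (per τ (k : ℕ) / 2 + l))| ≤ C)

/-- Multiplicities for equation `(★_k)`: `m₀ = m_k = 1`, the others `0`. -/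
def starM (k : ℕ) : Fin 4 → ℕ := fun j => if (j : ℕ) = 0 ∨ (j : ℕ) = k then 1 else 0

/-- `f` is a developing map of `u`: `f` is meromorphic on `ℂ` and
`u = log (8|f′|²/(1+|f|²)²)` wherever `f` is analytic with nonvanishing derivative. -/
def IsDevelopingMapOf (u : ℂ → ℝ) (f : ℂ → ℂ) : Prop :=
  (∀ z : ℂ, MeromorphicAt f z) ∧
  ∀ z : ℂ, AnalyticAt ℂ f z → deriv f z ≠ 0 →
    u z = Real.log (8 * ‖deriv f z‖ ^ 2 / (1 + ‖f z‖ ^ 2) ^ 2)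

/-- `f` satisfies the type II constraint for the torus `E_τ`. -/
def IsTypeII (τ : ℂ) (f : ℂ → ℂ) : Prop :=
  ∃ θ₁ θ₂ : ℝ,
    (∀ z, f (z + 1) = Complex.exp (2 * Complex.I * (θ₁ : ℂ)) * f z) ∧
    (∀ z, f (z + τ) = Complex.exp (2 * Complex.I * (θ₂ : ℂ)) * f z)

/-- The one-parameter family of solutions generated by the developing map `f`
(with members `u_β` having developing map `e^β f`) contains an even solution. -/
def FamilyHasEven (τ : ℂ) (m : Fin 4 → ℕ) (f : ℂ → ℂ) : Prop :=
  ∃ (β : ℝ) (v : ℂ → ℝ), IsCurvatureSolution τ m v ∧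
    IsDevelopingMapOf v (fun z => (Real.exp β : ℂ) * f z) ∧ ∀ z, v (-z) = v z

/-- `u`, with type II developing map `f`, generates a non-even family of solutions. -/
def GeneratesNonEvenFamily (τ : ℂ) (m : Fin 4 → ℕ) (u : ℂ → ℝ) (f : ℂ → ℂ) : Prop :=
  IsCurvatureSolution τ m u ∧ IsDevelopingMapOf u f ∧ IsTypeII τ f ∧ ¬ FamilyHasEven τ m f

/-- The curvature equation has a non-even family of solutions. -/
def HasNonEvenFamily (τ : ℂ) (m : Fin 4 → ℕ) : Prop :=
  ∃ u f, GeneratesNonEvenFamily τ m u f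

/-- The curvature equation has an even family of solutions. -/
def HasEvenFamily (τ : ℂ) (m : Fin 4 → ℕ) : Prop :=
  ∃ (u : ℂ → ℝ) (f : ℂ → ℂ), IsCurvatureSolution τ m u ∧ IsDevelopingMapOf u f ∧
    IsTypeII τ f ∧ FamilyHasEven τ m f

/-- `y` is a (meromorphic, global) solution of `y″ = q·y` away from the singular set `S`. -/
def SolvesODEOn (q : ℂ → ℂ) (S : Set ℂ) (y : ℂ → ℂ) : Prop :=
  (∀ z : ℂ, MeromorphicAt y z) ∧
  ∀ z ∉ S, AnalyticAt ℂ y z ∧ deriv (deriv y) z = q z * y z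

/-- Linear independence of two functions, tested away from the singular set `S`. -/
def LinIndepOn (S : Set ℂ) (y₁ y₂ : ℂ → ℂ) : Prop :=
  ∀ a b : ℂ, (∀ z ∉ S, a * y₁ z + b * y₂ z = 0) → a = 0 ∧ b = 0

/-- The equation `y″ = q·y` (with singular set `S`) on `E_τ` has unitary monodromy: there is a
fundamental system of solutions whose monodromy matrices w.r.t. `z ↦ z+1` and `z ↦ z+τ`
lie in `SU(2)`. -/
def HasUnitaryMonodromy (q : ℂ → ℂ) (S : Set ℂ) (τ : ℂ) : Prop :=
  ∃ y₁ y₂ : ℂ → ℂ, SolvesODEOn q S y₁ ∧ SolvesODEOn q S y₂ ∧ LinIndepOn S y₁ y₂ ∧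
    ∃ M₁ M₂ : Matrix (Fin 2) (Fin 2) ℂ,
      M₁ ∈ Matrix.unitaryGroup (Fin 2) ℂ ∧ M₁.det = 1 ∧
      M₂ ∈ Matrix.unitaryGroup (Fin 2) ℂ ∧ M₂.det = 1 ∧
      (∀ z, y₁ (z + 1) = M₁ 0 0 * y₁ z + M₁ 0 1 * y₂ z) ∧
      (∀ z, y₂ (z + 1) = M₁ 1 0 * y₁ z + M₁ 1 1 * y₂ z) ∧
      (∀ z, y₁ (z + τ) = M₂ 0 0 * y₁ z + M₂ 0 1 * y₂ z) ∧
      (∀ z, y₂ (z + τ) = M₂ 1 0 * y₁ z + M₂ 1 1 * y₂ z)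

/-- The potential of the Fuchsian equation `L(𝐦_k, T, E, τ)`. -/
def LPot (k : ℕ) (T E τ : ℂ) (z : ℂ) : ℂ :=
  2 * wp τ z + 2 * wp τ (z - per τ k / 2) +
    T * (wzeta τ (z - per τ k / 2) - wzeta τ z) - E

/-- The singular set of `L(𝐦_k, T, E, τ)`: lattice translates of `0` and `ω_k/2`. -/
def LSing (τ : ℂ) (k : ℕ) : Set ℂ := {z | ∃ l ∈ lat τ, z = l ∨ z = per τ k / 2 + l}

/-- The equation `y″ = q·y` is apparent (free of logarithmic singularity) at `p`: there are two
linearly independent single-valued solutions on a punctured neighborhood of `p`, both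
meromorphic at `p`. -/
def ApparentAt (q : ℂ → ℂ) (p : ℂ) : Prop :=
  ∃ (y₁ y₂ : ℂ → ℂ) (ε : ℝ), 0 < ε ∧
    (∀ z ∈ Metric.ball p ε, z ≠ p →
      AnalyticAt ℂ y₁ z ∧ AnalyticAt ℂ y₂ z ∧
      deriv (deriv y₁) z = q z * y₁ z ∧ deriv (deriv y₂) z = q z * y₂ z) ∧
    MeromorphicAt y₁ p ∧ MeromorphicAt y₂ p ∧
    ∀ a b : ℂ, (∀ z ∈ Metric.ball p ε, z ≠ p → a * y₁ z + b * y₂ z = 0) → a = 0 ∧ b = 0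

/-- The translated (even) potential `q_k(z;T,E)` of `L(𝐦_k, T, E, τ)`. -/
def qPot (k : ℕ) (T E τ : ℂ) (z : ℂ) : ℂ :=
  2 * (wp τ (z + per τ k / 4) + wp τ (z - per τ k / 4)) +
    T * (wzeta τ (z + per τ k / 4) - wzeta τ (z - per τ k / 4)) - E

/-- The singular set of the translated potential: lattice translates of `±ω_k/4`. -/
def qSing (τ : ℂ) (k : ℕ) : Set ℂ :=
  {z | ∃ l ∈ lat τ, z = per τ k / 4 + l ∨ z = -(per τ k / 4) + l}

/-- The even elliptic solution `Φ_e(z;T,E)` of the second symmetric product equation. -/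
def PhiE (τ : ℂ) (k : ℕ) (T E : ℂ) (z : ℂ) : ℂ :=
  (wpd τ (per τ k / 4)) ^ 4 / (wp τ z - wp τ (per τ k / 4)) ^ 2 +
  (wpd τ (per τ k / 4)) ^ 2 * (wpd τ (per τ k / 4) * T + wpdd τ (per τ k / 4)) /
      (wp τ z - wp τ (per τ k / 4)) +
  (1 / 4) * (4 * (wpd τ (per τ k / 4)) ^ 2 * E + 3 * (wpd τ (per τ k / 4)) ^ 2 * T ^ 2
    - 8 * wzeta τ (per τ k / 4) * (wpd τ (per τ k / 4)) ^ 2 * T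
    + 32 * wp τ (per τ k / 4) * (wpd τ (per τ k / 4)) ^ 2
    - 3 * (wpdd τ (per τ k / 4)) ^ 2)

/-- For `k ∈ {1,2,3}`, the other two indices, so that `{k, i, i′} = {1,2,3}`. -/
def otherTwo : ℕ → ℕ × ℕ
  | 1 => (2, 3)
  | 2 => (1, 3)
  | 3 => (1, 2)
  | _ => (0, 0)

/-- The Wirtinger derivative `∂_z g = (1/2)(∂_x g - i ∂_y g)`. -/
def wirt (g : ℂ → ℂ) (z : ℂ) : ℂ :=
  (1 / 2) * (fderiv ℝ g z (1 : ℂ) - Complex.I * fderiv ℝ g z Complex.I)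

/-- The potential `q(z) = -(1/2)(u_zz - (1/2) u_z²)` associated with a solution `u`. -/
def uPot (u : ℂ → ℝ) (z : ℂ) : ℂ :=
  -(1 / 2) * (wirt (wirt (fun w => ((u w : ℝ) : ℂ))) z -
    (1 / 2) * (wirt (fun w => ((u w : ℝ) : ℂ)) z) ^ 2)

/-- All lattice translates of the four half-periods. -/
def fullSing (τ : ℂ) : Set ℂ := {z | ∃ k : Fin 4, ∃ l ∈ lat τ, z = per τ (k : ℕ) / 2 + l}

/-- The potential of the general Fuchsian equation (with residues `T₁, T₂, T₃`). -/
def q8 (τ : ℂ) (m : Fin 4 → ℕ) (T₁ T₂ T₃ E : ℂ) (z : ℂ) : ℂ :=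
  (∑ k : Fin 4, (m k : ℂ) * ((m k : ℂ) + 1) * wp τ (z - per τ (k : ℕ) / 2)) +
  T₁ * (wzeta τ (z - per τ 1 / 2) - wzeta τ z) +
  T₂ * (wzeta τ (z - per τ 2 / 2) - wzeta τ z) +
  T₃ * (wzeta τ (z - per τ 3 / 2) - wzeta τ z) - E

/-- The elliptic-of-the-second-kind ansatz built from sigma functions. -/
def sigY (τ : ℂ) (k : ℕ) (a₁ a₂ c : ℂ) (z : ℂ) : ℂ :=
  Complex.exp (c * z) * wsigma τ (z - a₁) * wsigma τ (z - a₂) /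
    (wsigma τ (z - per τ k / 4) * wsigma τ (z + per τ k / 4))

end

namespace S19

lemma lat_countable (L : PeriodPair) : (L.lattice : Set ℂ).Countable :=
  Set.countable_coe_iff.mp (inferInstanceAs (Countable L.lattice))

lemma conn_compl {s : Set ℂ} (hs : s.Countable) : IsPreconnected sᶜ :=
  (hs.isConnected_compl_of_one_lt_rank (by simp)).isPreconnected

lemma evn {L : PeriodPair} {z : ℂ} (hz : z ∉ L.lattice) : ∀ᶠ x in 𝓝 z, x ∉ L.lattice :=
  L.isClosed_lattice.isOpen_compl.mem_nhds hz

lemma hasDerivAt_P (L : PeriodPair) {z : ℂ} (hz : z ∉ L.lattice) :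
    HasDerivAt L.weierstrassP (L.derivWeierstrassP z) z := by
  rw [← L.deriv_weierstrassP]
  exact (L.analyticOnNhd_weierstrassP z hz).differentiableAt.hasDerivAt

lemma not_const (L : PeriodPair) (e : ℂ) :
    ¬ ∀ z ∉ L.lattice, L.weierstrassP z = e := by
  intro h
  classical
  have h1 := L.order_weierstrassP 0 (by simp)
  have : L.weierstrassP =ᶠ[𝓝[≠] 0] fun _ => e := by
    filter_upwards [self_mem_nhdsWithin, mem_nhdsWithin_of_mem_nhds
      (L.compl_lattice_sdiff_singleton_mem_nhds 0)] with w hw hw'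
    apply h
    simp_all
  rw [meromorphicOrderAt_congr this, meromorphicOrderAt_const] at h1
  split_ifs at h1
  · exact absurd h1 (by decide)
  · exact absurd h1 (by decide)

lemma nc (L : PeriodPair) {z : ℂ} (hz : z ∉ L.lattice) (e : ℂ) :
    ∀ᶠ x in 𝓝[≠] z, L.weierstrassP x - e ≠ 0 := by
  have ha : AnalyticOnNhd ℂ (fun x => L.weierstrassP x - e) (L.lattice : Set ℂ)ᶜ :=
    L.analyticOnNhd_weierstrassP.sub analyticOnNhd_const
  rcases (ha z hz).eventually_eq_zero_or_eventually_ne_zero with h | h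
  · exfalso
    have := ha.eqOn_zero_of_preconnected_of_eventuallyEq_zero (conn_compl (lat_countable L)) hz h
    exact not_const L e fun z hz => sub_eq_zero.mp (this hz)
  · exact h

lemma ncd (L : PeriodPair) {z : ℂ} (hz : z ∉ L.lattice) :
    ∀ᶠ x in 𝓝[≠] z, L.derivWeierstrassP x ≠ 0 := by
  have ha := L.analyticOnNhd_derivWeierstrassP
  rcases (ha z hz).eventually_eq_zero_or_eventually_ne_zero with h | h
  · exfalso
    have h0 := ha.eqOn_zero_of_preconnected_of_eventuallyEq_zero (conn_compl (lat_countable L)) hz h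
    refine not_const L (L.weierstrassP z) fun x hx => ?_
    refine IsOpen.is_const_of_deriv_eq_zero L.isClosed_lattice.isOpen_compl
      (conn_compl (lat_countable L)) L.differentiableOn_weierstrassP ?_ hx hz
    rw [L.deriv_weierstrassP]
    exact h0
  · exact h

lemma hasDerivAt_dP (L : PeriodPair) {z : ℂ} (hz : z ∉ L.lattice) :
    HasDerivAt L.derivWeierstrassP (6 * L.weierstrassP z ^ 2 - L.g₂ / 2) z := by
  have han := L.analyticOnNhd_derivWeierstrassP
  have key : ∀ x ∉ L.lattice, L.derivWeierstrassP x ≠ 0 →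
      deriv L.derivWeierstrassP x - (6 * L.weierstrassP x ^ 2 - L.g₂ / 2) = 0 := by
    intro x hx hne
    have h1 := (han x hx).differentiableAt.hasDerivAt
    have h2 := hasDerivAt_P L hx
    have h3 := h1.fun_pow 2
    have h4 := (((h2.fun_pow 3).const_mul 4).sub (h2.const_mul L.g₂)).sub_const L.g₃
    have h5 : (fun x => L.derivWeierstrassP x ^ 2) =ᶠ[𝓝 x]
        (fun x => 4 * L.weierstrassP x ^ 3 - L.g₂ * L.weierstrassP x - L.g₃) := by
      filter_upwards [evn hx] with y hy using L.derivWeierstrassP_sq y hy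
    have h6 := h3.unique (h4.congr_of_eventuallyEq h5)
    apply mul_left_cancel₀ hne
    simp at h6
    linear_combination h6 / 2
  have hc : ContinuousAt (fun x => deriv L.derivWeierstrassP x -
      (6 * L.weierstrassP x ^ 2 - L.g₂ / 2)) z := by
    have h1 := (han z hz).deriv.continuousAt
    have h2 := (L.analyticOnNhd_weierstrassP z hz).continuousAt
    fun_prop
  have h0 : deriv L.derivWeierstrassP z - (6 * L.weierstrassP z ^ 2 - L.g₂ / 2) = 0 := by
    have t1 := hc.tendsto.mono_left (nhdsWithin_le_nhds (s := {z}ᶜ))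
    refine tendsto_nhds_unique (t1.congr' ?_) tendsto_const_nhds
    filter_upwards [ncd L hz, mem_nhdsWithin_of_mem_nhds (evn hz)] with x hx hx'
    exact key x hx' hx
  rw [← sub_eq_zero.mp h0]
  exact (han z hz).differentiableAt.hasDerivAt

/-- zeta of a period pair -/
noncomputable def wz (L : PeriodPair) (z : ℂ) : ℂ :=
  ∑' l : L.lattice, (1 / (z - l) + 1 / (l : ℂ) + z / (l : ℂ) ^ 2)

lemma wz_bound (r : ℝ) (hr : 0 < r) (s : ℂ) (hs : ‖s‖ < r) (l : ℂ) (h : 2 * r ≤ ‖l‖) :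
    ‖1 / (s - l) + 1 / l + s / l ^ 2‖ ≤ 2 * r ^ 2 * ‖l‖ ^ (-3 : ℝ) := by
  have hsl : s - l ≠ 0 := by rw [sub_ne_zero]; rintro rfl; linarith
  have hl : 0 < ‖l‖ := by linarith
  have hl' : l ≠ 0 := norm_pos_iff.mp hl
  have e : 1 / (s - l) + 1 / l + s / l ^ 2 = s ^ 2 / ((s - l) * l ^ 2) := by
    field_simp
    ring
  have hb : ‖l‖ / 2 ≤ ‖s - l‖ := by
    rw [norm_sub_rev]
    exact .trans (by linarith) (norm_sub_norm_le l s)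
  rw [e, norm_div, norm_mul, norm_pow, norm_pow]
  calc _ ≤ r ^ 2 / (‖l‖ / 2 * ‖l‖ ^ 2) := by gcongr
    _ = _ := by
      rw [Real.rpow_neg hl.le, show (3 : ℝ) = (3 : ℕ) by norm_num, Real.rpow_natCast]
      field_simp

lemma hslu_wz (L : PeriodPair) : HasSumLocallyUniformly
    (fun (l : L.lattice) (z : ℂ) ↦ 1 / (z - l) + 1 / (l : ℂ) + z / (l : ℂ) ^ 2) (wz L) := by
  refine L.hasSumLocallyUniformly_aux (u := fun r l => 2 * r ^ 2 * ‖l‖ ^ (-3 : ℝ)) _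
    (fun _ _ ↦ (ZLattice.summable_norm_rpow _ _ (by simp; norm_num)).mul_left _) fun r hr ↦
    Filter.eventually_atTop.mpr ⟨2 * r, ?_⟩
  rintro _ h s hs l rfl
  exact wz_bound r hr s hs l h

lemma hasDerivAt_term (l z : ℂ) (h : z - l ≠ 0) :
    HasDerivAt (fun z => 1 / (z - l) + 1 / l + z / l ^ 2) (-(1 / (z - l) ^ 2 - 1 / l ^ 2)) z := by
  have h1 := ((hasDerivAt_id' z).sub_const l).fun_inv h
  have h2 := (h1.add_const (1 / l)).fun_add ((hasDerivAt_id' z).div_const (l ^ 2))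
  simp only [one_div] at h2 ⊢
  exact h2.congr_deriv (by ring)

lemma hasDerivAt_wz (L : PeriodPair) {z : ℂ} (hz : z ∉ L.lattice) :
    HasDerivAt (wz L) (-L.weierstrassP z) z := by
  have ho : IsOpen ((L.lattice : Set ℂ)ᶜ) := L.isClosed_lattice.isOpen_compl
  have ht : ∀ x ∈ (L.lattice : Set ℂ)ᶜ, ∀ l : L.lattice, x - l ≠ 0 := by
    intro x hx l h
    obtain rfl := sub_eq_zero.mp h
    exact hx l.2
  have hu := (hslu_wz L).tendstoLocallyUniformlyOn (s := (L.lattice : Set ℂ)ᶜ)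
  have hd : ∀ s : Finset L.lattice, DifferentiableOn ℂ
      (fun z => ∑ l ∈ s, (1 / (z - l) + 1 / (l : ℂ) + z / (l : ℂ) ^ 2)) (L.lattice : Set ℂ)ᶜ := by
    intro s
    refine .fun_sum fun i hi x hx ↦ ?_
    exact (hasDerivAt_term i x (ht x hx i)).differentiableAt.differentiableWithinAt
  have hdiff := (hu.differentiableOn (.of_forall hd) ho).differentiableAt (ho.mem_nhds hz)
  have h1 := (hu.deriv (.of_forall hd) ho).tendsto_at hz
  have h2 := (L.hasSum_weierstrassP z).neg
  have : deriv (wz L) z = -L.weierstrassP z := by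
    refine tendsto_nhds_unique h1 (h2.congr fun s => ?_)
    simp only [Function.comp_apply]
    rw [HasDerivAt.deriv (HasDerivAt.fun_sum fun (i : L.lattice) _ =>
      hasDerivAt_term i z (ht z hz i))]
  rw [← this]
  exact hdiff.hasDerivAt

lemma wz_neg (L : PeriodPair) (z : ℂ) : wz L (-z) = - wz L z := by
  simp only [wz]
  rw [← (Equiv.neg L.lattice).tsum_eq, ← tsum_neg]
  congr with l
  have : -z - -(l : ℂ) = -(z - l) := by ring
  simp only [Equiv.neg_apply, NegMemClass.coe_neg, this, div_neg, neg_sq, neg_div]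
  ring

lemma wz_qp (L : PeriodPair) {w : ℂ} (hw : w ∉ L.lattice) (hw2 : w + w ∈ L.lattice)
    {z : ℂ} (hz : z ∉ L.lattice) : wz L (z + (w + w)) = wz L z + 2 * wz L w := by
  have ht : ∀ x ∉ L.lattice, x + (w + w) ∉ L.lattice := fun x hx h =>
    hx (by simpa using L.lattice.sub_mem h hw2)
  have hd : ∀ x ∉ L.lattice, HasDerivAt (fun z => wz L (z + (w + w)) - wz L z) 0 x := by
    intro x hx
    have h1 := ((hasDerivAt_wz L (ht x hx)).comp_add_const x (w + w)).fun_sub (hasDerivAt_wz L hx)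
    refine h1.congr_deriv ?_
    have := L.weierstrassP_add_coe x ⟨w + w, hw2⟩
    simp at this
    rw [this]; ring
  have hn : -w ∉ L.lattice := by simpa using hw
  have := IsOpen.is_const_of_deriv_eq_zero L.isClosed_lattice.isOpen_compl
    (conn_compl (lat_countable L)) (f := fun z => wz L (z + (w + w)) - wz L z)
    (fun x hx => (hd x hx).differentiableAt.differentiableWithinAt)
    (fun x hx => (hd x hx).deriv) hz hn
  simp [wz_neg] at this
  linear_combination this

lemma dP_half (L : PeriodPair) {w : ℂ} (hw2 : w + w ∈ L.lattice) :
    L.derivWeierstrassP w = 0 := by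
  have h := L.derivWeierstrassP_add_coe (-w) ⟨w + w, hw2⟩
  simp at h
  rw [← CharZero.eq_neg_self_iff]
  exact h

lemma exB (L : PeriodPair) {w : ℂ} (hw : w ∉ L.lattice) (hw2 : w + w ∈ L.lattice) :
    ∃ B : ℂ → ℂ, AnalyticAt ℂ B 0 ∧
      (∀ᶠ z in 𝓝 0, L.weierstrassP (z + w) - L.weierstrassP w = z ^ 2 * B z) ∧
      B 0 = 3 * L.weierstrassP w ^ 2 - L.g₂ / 4 := by
  have ha : AnalyticAt ℂ (fun z => L.weierstrassP (z + w) - L.weierstrassP w) 0 := by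
    have h0 : AnalyticAt ℂ L.weierstrassP (0 + w) := by
      rw [zero_add]; exact L.analyticOnNhd_weierstrassP w hw
    exact (h0.fun_comp (f := fun z => z + w) (by fun_prop)).sub analyticAt_const
  have hd0 : ∀ᶠ z in 𝓝 (0 : ℂ), z + w ∉ L.lattice := by
    have : Tendsto (fun z : ℂ => z + w) (𝓝 0) (𝓝 w) := by
      have h : ContinuousAt (fun z : ℂ => z + w) 0 := by fun_prop
      simpa [ContinuousAt] using h
    exact this.eventually (evn hw)
  have hd1 : deriv (fun z => L.weierstrassP (z + w) - L.weierstrassP w) =ᶠ[𝓝 0]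
      fun z => L.derivWeierstrassP (z + w) := by
    filter_upwards [hd0] with z hz
    exact (((hasDerivAt_P L hz).comp_add_const z w).sub_const _).deriv
  obtain ⟨B, hB, hBe⟩ := (natCast_le_analyticOrderAt ha (n := 2)).mp (by
    rw [natCast_le_analyticOrderAt_iff_iteratedDeriv_eq_zero ha]
    intro i hi
    interval_cases i
    · simp
    · rw [iteratedDeriv_one, hd1.eq_of_nhds]
      simpa using dP_half L hw2)
  simp only [sub_zero, smul_eq_mul] at hBe
  refine ⟨B, hB, hBe, ?_⟩
  have h2 : HasDerivAt (fun z => L.derivWeierstrassP (z + w))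
      (6 * L.weierstrassP w ^ 2 - L.g₂ / 2) 0 := by
    have := (hasDerivAt_dP L (z := 0 + w) (by simpa using hw)).comp_add_const 0 w
    simpa using this
  have h3 : (fun z => L.derivWeierstrassP (z + w)) =ᶠ[𝓝 0]
      fun z => 2 * z * B z + z ^ 2 * deriv B z := by
    have hBe' : (fun z => L.weierstrassP (z + w) - L.weierstrassP w) =ᶠ[𝓝 0]
      fun z => z ^ 2 * B z := hBe
    filter_upwards [hBe'.deriv, hd1, hB.eventually_analyticAt] with z h1 h2 h3
    rw [← h2, h1]
    have := ((hasDerivAt_id' z).fun_pow 2).fun_mul h3.differentiableAt.hasDerivAt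
    rw [this.deriv]
    simp
  have h4 : HasDerivAt (fun z => 2 * z * B z + z ^ 2 * deriv B z) (2 * B 0) 0 := by
    have a1 := ((hasDerivAt_id' (0 : ℂ)).const_mul 2).fun_mul hB.differentiableAt.hasDerivAt
    have a2 := ((hasDerivAt_id' (0 : ℂ)).fun_pow 2).fun_mul hB.deriv.differentiableAt.hasDerivAt
    exact (a1.fun_add a2).congr_deriv (by simp)
  have h5 := h2.unique (h4.congr_of_eventuallyEq h3)
  linear_combination -h5 / 2

open Classical in
lemma prod_const (L : PeriodPair) {w : ℂ} (hw : w ∉ L.lattice) (hw2 : w + w ∈ L.lattice)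
    {z : ℂ} (hz : z ∉ L.lattice) (hzw : z + w ∉ L.lattice) :
    (L.weierstrassP z - L.weierstrassP w) * (L.weierstrassP (z + w) - L.weierstrassP w) =
      3 * L.weierstrassP w ^ 2 - L.g₂ / 4 := by
  obtain ⟨B, hB, hBe, hB0⟩ := exB L hw hw2
  set e := L.weierstrassP w with he
  set C := 3 * e ^ 2 - L.g₂ / 4 with hC
  set H : ℂ → ℂ := fun z => if z ∈ L.lattice ∨ z + w ∈ L.lattice then C else
    (L.weierstrassP z - e) * (L.weierstrassP (z + w) - e) with hH
  have hP : ∀ z l, l ∈ L.lattice → L.weierstrassP (z + l) = L.weierstrassP z :=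
    fun z l hl => L.weierstrassP_add_coe z ⟨l, hl⟩
  have hmem : ∀ z l, l ∈ L.lattice → (z + l ∈ L.lattice ↔ z ∈ L.lattice) := fun z l hl =>
    L.lattice.toAddSubgroup.add_mem_cancel_right (y := z) hl
  have hper : ∀ z l, l ∈ L.lattice → H (z + l) = H z := by
    intro z l hl
    simp only [hH]
    rw [add_right_comm z l w, hmem z l hl, hmem (z + w) l hl, hP z l hl, hP (z + w) l hl]
  have hperw : ∀ z, H (z + w) = H z := by
    intro z
    simp only [hH]
    rw [add_assoc z w w, hmem z _ hw2, hP z _ hw2, mul_comm]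
    simp only [or_comm]
  have ha0 : DifferentiableAt ℂ H 0 := by
    have hA := L.analyticAt_weierstrassPExcept 0
    have : DifferentiableAt ℂ (fun z => B z + z ^ 2 * (L.weierstrassPExcept 0 z - e) * B z) 0 := by
      have h1 := hA.differentiableAt
      have h2 := hB.differentiableAt
      fun_prop
    refine this.congr_of_eventuallyEq ?_
    have hd0 : ∀ᶠ z in 𝓝 (0 : ℂ), z + w ∉ L.lattice := by
      have : Tendsto (fun z : ℂ => z + w) (𝓝 0) (𝓝 w) := by
        have h : ContinuousAt (fun z : ℂ => z + w) 0 := by fun_prop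
        simpa [ContinuousAt] using h
      exact this.eventually (evn hw)
    filter_upwards [hBe, hd0, L.compl_lattice_sdiff_singleton_mem_nhds 0] with z h1 h2 h3
    by_cases hz0 : z = 0
    · subst hz0
      simp [hH, hB0]
    · have hzL : z ∉ L.lattice := by simp_all
      simp only [hH, hzL, h2, or_self, if_false]
      have h4 := L.weierstrassPExcept_add 0 z
      simp at h4
      rw [h1, ← h4]
      field_simp
      ring
  have htr : ∀ a z : ℂ, (∀ x, H (x + a) = H x) → DifferentiableAt ℂ H z →
      DifferentiableAt ℂ H (z - a) := by
    intro a z h hd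
    have : H = fun x => H (x + a) := by ext x; rw [h]
    rw [this]
    have hd' : DifferentiableAt ℂ H (z - a + a) := by simpa using hd
    exact hd'.comp (z - a) (f := fun x => x + a) (by fun_prop)
  have hdiff : Differentiable ℂ H := by
    intro x
    by_cases hx : x ∈ L.lattice
    · have := htr (-x) 0 (fun y => hper y _ (L.lattice.neg_mem hx)) ha0
      simpa using this
    by_cases hxw : x + w ∈ L.lattice
    · have h1 := htr (-(x + w)) 0 (fun y => hper y _ (L.lattice.neg_mem hxw)) ha0
      have := htr w _ hperw h1
      simpa using this
    · have h1 := (L.analyticOnNhd_weierstrassP x hx).differentiableAt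
      have h2 : DifferentiableAt ℂ (fun y => L.weierstrassP (y + w)) x :=
        ((hasDerivAt_P L hxw).comp_add_const x w).differentiableAt
      have h3 : DifferentiableAt ℂ
        (fun z => (L.weierstrassP z - e) * (L.weierstrassP (z + w) - e)) x := by fun_prop
      refine h3.congr_of_eventuallyEq ?_
      have h4 : ContinuousAt (fun z : ℂ => z + w) x := by fun_prop
      filter_upwards [evn hx, h4.tendsto.eventually (evn hxw)] with y hy hy'
      simp [hH, hy, hy']
  have := hdiff.apply_eq_apply_of_bounded (IsZLattice.isCompact_range_of_periodic L.lattice _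
    hdiff.continuous hper).isBounded z 0
  simpa [hH, hz, hzw] using this

lemma C_ne (L : PeriodPair) {w : ℂ} (hw : w ∉ L.lattice) (hw2 : w + w ∈ L.lattice)
    {z : ℂ} (hz : z ∉ L.lattice) (hzw : z + w ∉ L.lattice) :
    3 * L.weierstrassP w ^ 2 - L.g₂ / 4 ≠ 0 := by
  have h4 : ContinuousAt (fun z : ℂ => z + w) z := by fun_prop
  have h5 : Tendsto (fun x : ℂ => x + w) (𝓝[≠] z) (𝓝[≠] (z + w)) := by
    refine tendsto_nhdsWithin_iff.mpr ⟨h4.tendsto.mono_left nhdsWithin_le_nhds, ?_⟩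
    filter_upwards [self_mem_nhdsWithin] with x hx
    simpa using hx
  have : ∀ᶠ x in 𝓝[≠] z, 3 * L.weierstrassP w ^ 2 - L.g₂ / 4 ≠ 0 := by
    filter_upwards [nc L hz (L.weierstrassP w), h5.eventually (nc L hzw (L.weierstrassP w)),
      mem_nhdsWithin_of_mem_nhds (evn hz),
      mem_nhdsWithin_of_mem_nhds (h4.tendsto.eventually (evn hzw))] with x h1 h2 h3 h4
    rw [← prod_const L hw hw2 h3 h4]
    exact mul_ne_zero h1 h2
  exact this.exists.choose_spec

lemma main (L : PeriodPair) {w : ℂ} (hw : w ∉ L.lattice) (hw2 : w + w ∈ L.lattice)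
    {z : ℂ} (hz : z ∉ L.lattice) (hzw : z + w ∉ L.lattice) :
    L.weierstrassP z - L.weierstrassP w ≠ 0 ∧
    wz L (z + w) = wz L z + wz L w +
      L.derivWeierstrassP z / (2 * (L.weierstrassP z - L.weierstrassP w)) := by
  have hC := C_ne L hw hw2 hz hzw
  have hne : ∀ x, x ∉ L.lattice → x + w ∉ L.lattice → L.weierstrassP x - L.weierstrassP w ≠ 0 := by
    intro x h1 h2 h
    apply hC
    rw [← prod_const L hw hw2 h1 h2, h, zero_mul]
  refine ⟨hne z hz hzw, ?_⟩
  set e := L.weierstrassP w with he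
  set F : ℂ → ℂ := fun x => wz L (x + w) - wz L x -
    L.derivWeierstrassP x / (2 * (L.weierstrassP x - e)) with hF
  have hsq0 : 4 * e ^ 3 - L.g₂ * e - L.g₃ = 0 := by
    rw [he, ← L.derivWeierstrassP_sq w hw, dP_half L hw2]; simp
  have hd : ∀ x, x ∉ L.lattice → x + w ∉ L.lattice → HasDerivAt F 0 x := by
    intro x h1 h2
    have hn := hne x h1 h2
    have d1 := (hasDerivAt_wz L h2).comp_add_const x w
    have d2 := hasDerivAt_wz L h1
    have d3 := (hasDerivAt_dP L h1).fun_div (((hasDerivAt_P L h1).sub_const e).const_mul 2)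
      (mul_ne_zero two_ne_zero hn)
    refine ((d1.fun_sub d2).fun_sub d3).congr_deriv ?_
    have hp := prod_const L hw hw2 h1 h2
    have hs := L.derivWeierstrassP_sq x h1
    rw [← he] at hp
    have hq : L.weierstrassP (x + w) =
        e + (3 * e ^ 2 - L.g₂ / 4) / (L.weierstrassP x - e) := by
      rw [← hp]; field_simp; ring
    rw [hq]
    field_simp
    have hg3 : L.g₃ = 4 * e ^ 3 - L.g₂ * e := by linear_combination -hsq0
    rw [hg3] at hs
    linear_combination 8 * hs
  set S : Set ℂ := (L.lattice : Set ℂ) ∪ (fun x => x + w) ⁻¹' (L.lattice : Set ℂ) with hS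
  have hScount : S.Countable :=
    (lat_countable L).union ((lat_countable L).preimage (add_left_injective w))
  have hSopen : IsOpen Sᶜ :=
    (L.isClosed_lattice.union (L.isClosed_lattice.preimage (by fun_prop))).isOpen_compl
  have hSm : ∀ x, x ∈ Sᶜ ↔ x ∉ L.lattice ∧ x + w ∉ L.lattice := by
    intro x; simp [hS]
  have hd' : ∀ x ∈ Sᶜ, HasDerivAt F 0 x := fun x hx => hd x ((hSm x).1 hx).1 ((hSm x).1 hx).2
  have hzm : z - w ∉ L.lattice := fun h => hzw (by
    have := L.lattice.add_mem h hw2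
    rwa [show z - w + (w + w) = z + w by ring] at this)
  have hnz : -z ∈ Sᶜ := by
    rw [hSm]
    refine ⟨by simpa using hz, ?_⟩
    rw [show -z + w = -(z - w) by ring]
    exact L.lattice.neg_mem_iff.not.mpr hzm
  have hc := IsOpen.is_const_of_deriv_eq_zero hSopen (conn_compl hScount) (f := F)
    (fun x hx => (hd' x hx).differentiableAt.differentiableWithinAt)
    (fun x hx => (hd' x hx).deriv) ((hSm z).2 ⟨hz, hzw⟩) hnz
  have hq := wz_qp L hw hw2 hzm
  rw [show z - w + (w + w) = z + w by ring] at hq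
  simp only [hF, wz_neg, L.weierstrassP_neg, L.derivWeierstrassP_neg] at hc
  rw [show -z + w = -(z - w) by ring, wz_neg, neg_div] at hc
  linear_combination hc / 2 + hq / 2

lemma tsum_split (f : ℤ × ℤ → ℂ) (hf : Summable f) :
    f 0 + ∑' p : {p : ℤ × ℤ // p ≠ 0}, f p.1 = ∑' p, f p := by
  have h := hf.tsum_subtype_add_tsum_subtype_compl {0}
  rw [tsum_singleton 0 f] at h
  exact h

lemma indep_tau {τ : ℂ} (hτ : 0 < τ.im) : LinearIndependent ℝ ![(1 : ℂ), τ] := by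
  rw [LinearIndependent.pair_iff]
  intro s t h
  have h2 := congrArg Complex.im h
  have h1 := congrArg Complex.re h
  simp at h1 h2
  rcases h2 with rfl | h2
  · simpa using h1
  · exact absurd h2 hτ.ne'

/-- the period pair of tau -/
noncomputable def LL {τ : ℂ} (hτ : 0 < τ.im) : PeriodPair := ⟨1, τ, indep_tau hτ⟩

lemma mem_LL {τ : ℂ} (hτ : 0 < τ.im) (z : ℂ) : z ∈ (LL hτ).lattice ↔ z ∈ lat τ := by
  rw [PeriodPair.mem_lattice]
  simp [LL, lat, eq_comm]

lemma symm_LL {τ : ℂ} (hτ : 0 < τ.im) (p : ℤ × ℤ) :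
    (((LL hτ).latticeEquivProd.symm p : (LL hτ).lattice) : ℂ) = latPt τ p := by
  rw [PeriodPair.latticeEquiv_symm_apply]
  simp [LL, latPt]

lemma tsum_LL {τ : ℂ} (hτ : 0 < τ.im) (f : ℂ → ℂ)
    (hf : Summable fun l : (LL hτ).lattice => f l) :
    f 0 + ∑' p : {p : ℤ × ℤ // p ≠ 0}, f (latPt τ p.1) = ∑' l : (LL hτ).lattice, f l := by
  have h := (LL hτ).latticeEquivProd.symm.toEquiv.tsum_eq (fun l : (LL hτ).lattice => f l)
  have h' := (LL hτ).latticeEquivProd.symm.toEquiv.summable_iff.mpr hf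
  rw [← h]
  simp only [Function.comp_def, LinearEquiv.coe_toEquiv, symm_LL] at h' ⊢
  rw [← tsum_split _ h']
  simp [latPt]

lemma wp_eq {τ : ℂ} (hτ : 0 < τ.im) : wp τ = (LL hτ).weierstrassP := by
  ext z
  have := tsum_LL hτ (fun l => 1 / (z - l) ^ 2 - 1 / l ^ 2)
    ((LL hτ).hasSum_weierstrassP z).summable
  simp only [wp, PeriodPair.weierstrassP]
  rw [← this]
  simp

lemma wzeta_eq {τ : ℂ} (hτ : 0 < τ.im) : wzeta τ = wz (LL hτ) := by
  ext z
  have := tsum_LL hτ (fun l => 1 / (z - l) + 1 / l + z / l ^ 2)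
    (hslu_wz (LL hτ)).hasSum.summable
  simp only [wzeta, wz]
  rw [← this]
  simp

lemma half_not_mem {τ : ℂ} (hτ : 0 < τ.im) (a b : ℤ) (h : ¬ (Even a ∧ Even b)) :
    ((a : ℂ) + b * τ) / 2 ∉ (LL hτ).lattice := by
  rw [mem_LL]
  rintro ⟨m, n, h0⟩
  apply h
  have h1 := congrArg Complex.im h0
  have hb : (b : ℝ) = 2 * n := by
    have : (b : ℝ) * τ.im = 2 * n * τ.im := by
      simp at h1
      linarith
    exact mul_right_cancel₀ hτ.ne' this
  have hb' : b = 2 * n := by exact_mod_cast hb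
  subst hb'
  have ha : (a : ℂ) = 2 * m := by
    push_cast at h0
    linear_combination 2 * h0
  have ha' : a = 2 * m := by exact_mod_cast ha
  exact ⟨⟨m, by omega⟩, ⟨n, by omega⟩⟩

lemma mem_int {τ : ℂ} (hτ : 0 < τ.im) (a b : ℤ) :
    ((a : ℂ) + b * τ) / 2 + ((a : ℂ) + b * τ) / 2 ∈ (LL hτ).lattice := by
  rw [mem_LL]
  exact ⟨a, b, by ring⟩

lemma eta_sum {τ : ℂ} (hτ : 0 < τ.im) :
    wz (LL hτ) ((1 + τ) / 2) = wz (LL hτ) (1 / 2) + wz (LL hτ) (τ / 2) := by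
  have n1 : (1 / 2 : ℂ) ∉ (LL hτ).lattice := by
    simpa using half_not_mem hτ 1 0 (by decide)
  have n2 : τ / 2 ∉ (LL hτ).lattice := by
    simpa using half_not_mem hτ 0 1 (by decide)
  have n3 : (1 + τ) / 2 ∉ (LL hτ).lattice := by
    simpa using half_not_mem hτ 1 1 (by decide)
  have m1 : (1 / 2 : ℂ) + 1 / 2 ∈ (LL hτ).lattice := by
    simpa using mem_int hτ 1 0
  have m2 : τ / 2 + τ / 2 ∈ (LL hτ).lattice := by
    simpa using mem_int hτ 0 1
  have hn : -((1 + τ) / 2) ∉ (LL hτ).lattice := (LL hτ).lattice.neg_mem_iff.not.mpr n3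
  have q1 := wz_qp (LL hτ) n1 m1 hn
  have h' : -((1 + τ) / 2) + (1 / 2 + 1 / 2) ∉ (LL hτ).lattice := fun h =>
    hn (by simpa using (LL hτ).lattice.sub_mem h m1)
  have q2 := wz_qp (LL hτ) n2 m2 h'
  rw [q1, wz_neg, show -((1 + τ) / 2) + (1 / 2 + 1 / 2) + (τ / 2 + τ / 2) = (1 + τ) / 2 by ring]
    at q2
  linear_combination q2 / 2

end S19

/-- **Theorem (Statement 19).** For `σ = r + sτ` avoiding `Λ_τ` and `ω_k/2 + Λ_τ`, we have
`Z(r_k,s_k,τ) = Z(r,s,τ) + ℘′(σ)/(2(℘(σ) - e_k))`; consequently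
`2Z(r,s,τ)(℘(σ) - e_k) + ℘′(σ) = 0` iff `Z(r_k,s_k,τ) = 0`. -/
theorem statement19 (τ : ℂ) (hτ : 0 < τ.im) (k : ℕ) (hk : k = 1 ∨ k = 2 ∨ k = 3)
    (r s : ℂ) (h1 : r + s * τ ∉ lat τ) (h2 : r + s * τ - per τ k / 2 ∉ lat τ) :
    heckeZ (rkr k r) (rks k s) τ =
      heckeZ r s τ + wpd τ (r + s * τ) / (2 * (wp τ (r + s * τ) - eper τ k)) ∧
    (2 * heckeZ r s τ * (wp τ (r + s * τ) - eper τ k) + wpd τ (r + s * τ) = 0 ↔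
      heckeZ (rkr k r) (rks k s) τ = 0) := by
  have hper : ∃ a b : ℤ, ¬ (Even a ∧ Even b) ∧ per τ k = a + b * τ ∧
      rkr k r = r + a / 2 ∧ rks k s = s + b / 2 ∧
      2 * wzeta τ (per τ k / 2) = a * eta1 τ + b * eta2 τ := by
    rcases hk with rfl | rfl | rfl
    · exact ⟨1, 0, by decide, by simp [per], by simp [rkr], by simp [rks], by simp [per, eta1]⟩
    · exact ⟨0, 1, by decide, by simp [per], by simp [rkr], by simp [rks], by simp [per, eta2]⟩
    · refine ⟨1, 1, by decide, by simp [per], by simp [rkr], by simp [rks], ?_⟩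
      simp only [per, eta1, eta2, S19.wzeta_eq hτ, S19.eta_sum hτ]
      push_cast
      ring
  obtain ⟨a, b, hab, hp, hr, hs, he⟩ := hper
  have hw : per τ k / 2 ∉ (S19.LL hτ).lattice := by
    rw [hp]; exact S19.half_not_mem hτ a b hab
  have hw2 : per τ k / 2 + per τ k / 2 ∈ (S19.LL hτ).lattice := by
    rw [hp]; exact S19.mem_int hτ a b
  rw [← S19.mem_LL hτ] at h1 h2
  have h3 : r + s * τ + per τ k / 2 ∉ (S19.LL hτ).lattice := fun h => h2 (by
    have := (S19.LL hτ).lattice.sub_mem h hw2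
    rwa [show r + s * τ + per τ k / 2 - (per τ k / 2 + per τ k / 2)
      = r + s * τ - per τ k / 2 by ring] at this)
  obtain ⟨hne, hm⟩ := S19.main (S19.LL hτ) hw hw2 h1 h3
  rw [← S19.wzeta_eq hτ, ← S19.wp_eq hτ, ← PeriodPair.deriv_weierstrassP, ← S19.wp_eq hτ] at hm
  rw [← S19.wp_eq hτ] at hne
  have hmain : heckeZ (rkr k r) (rks k s) τ =
      heckeZ r s τ + wpd τ (r + s * τ) / (2 * (wp τ (r + s * τ) - eper τ k)) := by
    have hx : rkr k r + rks k s * τ = r + s * τ + per τ k / 2 := by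
      rw [hr, hs, hp]; ring
    simp only [heckeZ, hx, wpd, eper]
    rw [hm, hr, hs]
    linear_combination he / 2
  refine ⟨hmain, ?_⟩
  have hne' : wp τ (r + s * τ) - eper τ k ≠ 0 := hne
  have hz : heckeZ r s τ + wpd τ (r + s * τ) / (2 * (wp τ (r + s * τ) - eper τ k)) =
      (2 * heckeZ r s τ * (wp τ (r + s * τ) - eper τ k) + wpd τ (r + s * τ)) /
        (2 * (wp τ (r + s * τ) - eper τ k)) := by
    field_simp
  rw [hmain, hz, div_eq_zero_iff]
  simp [hne']
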